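/- arXiv:1906.10611 — 7 statements merged into one kernel-verified Lean document; each statement's English description precedes it below -/
import Mathlib

section
/- For all natural numbers n ≥ 1 and 1 ≤ t ≤ 2ⁿ − 1, the trace distance between the t-copy random binary phase mixed state and the t-copy random complex phase mixed state satisfies td(ρ_{(t,n,2)}, ρ_{(t,n,2ⁿ)}) ≤ ∏_{i=1}^{t−1}(1 + i/2ⁿ) − ∏_{i=1}^{t−1}(1 − i/2ⁿ). -/
open MeasureTheory
open scoped BigOperators Classical

noncomputable section

/-- Bit strings of length `n`, i.e. elements of `{0,1}ⁿ`. -/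
abbrev Str (n : ℕ) := Fin n → Bool

/-- Tuples of `t` strings from `{0,1}ⁿ`. -/
abbrev Tup (n t : ℕ) := Fin t → Str n

/-- The binary phase state `|f⟩₂ = 2^{-n/2} Σ_x (-1)^{f(x)} |x⟩` for `f : {0,1}ⁿ → {0,1}`. -/
def ket2 (n : ℕ) (f : Str n → Bool) : Str n → ℂ :=
  fun x => (if f x then (-1 : ℂ) else 1) / Real.sqrt (2 ^ n)

/-- The `t`-fold tensor-power outer product `(v v†)^{⊗ t}` of a vector `v ∈ ℂ^{2ⁿ}`,
as a `2^{tn} × 2^{tn}` matrix indexed by tuples in `({0,1}ⁿ)ᵗ`. -/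
def outerT (n t : ℕ) (v : Str n → ℂ) : Matrix (Tup n t) (Tup n t) ℂ :=
  Matrix.of fun x y => (∏ i, v (x i)) * (starRingEnd ℂ) (∏ i, v (y i))

/-- `ρ_{(t,n,2)}`: the `t`-copy random binary phase mixed state, the expectation of
`(|f⟩₂⟨f|₂)^{⊗t}` over a uniformly random `f : {0,1}ⁿ → {0,1}`. -/
def rho2 (n t : ℕ) : Matrix (Tup n t) (Tup n t) ℂ :=
  (Fintype.card (Str n → Bool) : ℂ)⁻¹ • ∑ f : Str n → Bool, outerT n t (ket2 n f)

/-- The complex phase state `|f⟩_{2ⁿ} = 2^{-n/2} Σ_x ω^{f(x)} |x⟩`, `ω = e^{2πi/2ⁿ}`,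
for `f : {0,1}ⁿ → {0,…,2ⁿ-1}`. -/
def ketC (n : ℕ) (f : Str n → Fin (2 ^ n)) : Str n → ℂ :=
  fun x => Complex.exp (2 * Real.pi * Complex.I * ((f x : ℕ) : ℂ) / (2 ^ n)) / Real.sqrt (2 ^ n)

/-- `ρ_{(t,n,2ⁿ)}`: the `t`-copy random complex phase mixed state, the expectation of
`(|f⟩_{2ⁿ}⟨f|_{2ⁿ})^{⊗t}` over a uniformly random `f : {0,1}ⁿ → {0,…,2ⁿ-1}`. -/
def rhoC (n t : ℕ) : Matrix (Tup n t) (Tup n t) ℂ :=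
  (Fintype.card (Str n → Fin (2 ^ n)) : ℂ)⁻¹ • ∑ f : Str n → Fin (2 ^ n), outerT n t (ketC n f)

open scoped ComplexOrder

/-- If a Hermitian matrix is a difference of positive semidefinite matrices `B` and `C`, then its
trace norm is at most `tr B + tr C`. -/
theorem sum_abs_eigenvalues_le_of_eq_sub {m : Type*} [Fintype m] [DecidableEq m]
    {A B C : Matrix m m ℂ} (hA : A.IsHermitian) (hB : B.PosSemidef) (hC : C.PosSemidef)
    (hABC : A = B - C) : ∑ i, |hA.eigenvalues i| ≤ B.trace.re + C.trace.re := by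
  let U : Matrix m m ℂ := hA.eigenvectorUnitary.val
  have hUU : U * U.conjTranspose = 1 := Unitary.coe_mul_star_self hA.eigenvectorUnitary
  have hUU' : U.conjTranspose * U = 1 := Unitary.coe_star_mul_self hA.eigenvectorUnitary
  have hdiag : U.conjTranspose * A * U = Matrix.diagonal (fun i => (hA.eigenvalues i : ℂ)) := by
    conv_lhs => rw [hA.spectral_theorem]
    rw [Unitary.conjStarAlgAut_apply]
    change U.conjTranspose * (U * _ * U.conjTranspose) * U = _
    rw [← mul_assoc, ← mul_assoc, hUU', one_mul, mul_assoc, hUU', mul_one]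
    rfl
  have htr (M : Matrix m m ℂ) : (U.conjTranspose * M * U).trace = M.trace := by
    rw [Matrix.trace_mul_comm, ← mul_assoc, hUU, one_mul]
  have hB' := hB.conjTranspose_mul_mul_same U
  have hC' := hC.conjTranspose_mul_mul_same U
  rw [← htr B, ← htr C, Matrix.trace, Matrix.trace, Complex.re_sum, Complex.re_sum,
    ← Finset.sum_add_distrib]
  refine Finset.sum_le_sum fun i _ => ?_
  have hi : hA.eigenvalues i =
      ((U.conjTranspose * B * U) i i).re - ((U.conjTranspose * C * U) i i).re := by
    have hsub : U.conjTranspose * B * U - U.conjTranspose * C * U =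
        Matrix.diagonal (fun i => (hA.eigenvalues i : ℂ)) := by
      rw [← sub_mul, ← mul_sub, ← hABC, hdiag]
    have := congrArg (fun M => (M i i).re) hsub
    simp only [Matrix.sub_apply, Complex.sub_re,
      Matrix.diagonal_apply_eq, Complex.ofReal_re] at this
    exact this.symm
  have h1 : 0 ≤ ((U.conjTranspose * B * U) i i).re :=
    (Complex.nonneg_iff.mp hB'.diag_nonneg).1
  have h2 : 0 ≤ ((U.conjTranspose * C * U) i i).re :=
    (Complex.nonneg_iff.mp hC'.diag_nonneg).1
  rw [hi, Matrix.diag_apply, Matrix.diag_apply, abs_le]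
  constructor <;> linarith

/-- The `t`-copy mixed state of the vectors `x ↦ g (f x)` for uniformly random `f`. -/
def phaseMixture (n t : ℕ) {α : Type} [Fintype α] (g : α → ℂ) : Matrix (Tup n t) (Tup n t) ℂ :=
  (Fintype.card (Str n → α) : ℂ)⁻¹ • ∑ f : Str n → α, outerT n t (fun x => g (f x))

theorem outerT_posSemidef (n t : ℕ) (v : Str n → ℂ) : (outerT n t v).PosSemidef :=
  Matrix.posSemidef_vecMulVec_self_star fun x : Tup n t => ∏ i, v (x i)

section phaseMixture

variable {n t : ℕ} {α : Type} [Fintype α] {g : α → ℂ}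

theorem phaseMixture_posSemidef : (phaseMixture n t g).PosSemidef :=
  (Matrix.posSemidef_sum _ fun _ _ => outerT_posSemidef n t _).smul
    (inv_nonneg.mpr (Nat.cast_nonneg _))

theorem phaseMixture_apply_comp_perm [Nonempty α]
    (hg : ∀ a, g a * (starRingEnd ℂ) (g a) = (2 ^ n : ℂ)⁻¹) (x : Tup n t)
    (σ : Equiv.Perm (Fin t)) : phaseMixture n t g x (x ∘ σ) = ((2 ^ n : ℂ)⁻¹) ^ t := by
  have key (f : Str n → α) :
      outerT n t (fun s => g (f s)) x (x ∘ σ) = ((2 ^ n : ℂ)⁻¹) ^ t := by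
    have hσ : ∏ i, g (f ((x ∘ σ) i)) = ∏ i, g (f (x i)) :=
      Equiv.prod_comp σ fun i => g (f (x i))
    simp only [outerT, Matrix.of_apply, hσ]
    simp [map_prod, ← Finset.prod_mul_distrib, hg]
  rw [phaseMixture, Matrix.smul_apply, Matrix.sum_apply, Finset.sum_congr rfl fun f _ => key f,
    Finset.sum_const, Finset.card_univ, nsmul_eq_mul, smul_eq_mul, inv_mul_cancel_left₀]
  exact Nat.cast_ne_zero.mpr Fintype.card_ne_zero

theorem phaseMixture_apply_eq_zero (hg : ∑ a, g a = 0) {x y : Tup n t}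
    (hx : Function.Injective x) {i : Fin t} (hi : ∀ j, y j ≠ x i) :
    phaseMixture n t g x y = 0 := by
  have key (f : Str n → α) : outerT n t (fun s => g (f s)) x y =
      ∏ s, ((∏ _j with x _j = s, g (f s)) *
        (starRingEnd ℂ) (∏ _j with y _j = s, g (f s))) := by
    rw [Finset.prod_mul_distrib, ← map_prod]
    simp only [outerT, Matrix.of_apply]
    refine congrArg₂ (fun a b => a * (starRingEnd ℂ) b) ?_ ?_
    · rw [← Finset.prod_fiberwise Finset.univ x]
      exact Finset.prod_congr rfl fun s _ => Finset.prod_congr rfl fun j hj => by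
        rw [(Finset.mem_filter.mp hj).2]
    · rw [← Finset.prod_fiberwise Finset.univ y]
      exact Finset.prod_congr rfl fun s _ => Finset.prod_congr rfl fun j hj => by
        rw [(Finset.mem_filter.mp hj).2]
  have hprod := Fintype.prod_sum fun (s : Str n) (a : α) =>
    (∏ _j with x _j = s, g a) * (starRingEnd ℂ) (∏ _j with y _j = s, g a)
  rw [phaseMixture, Matrix.smul_apply, Matrix.sum_apply, Finset.sum_congr rfl fun f _ => key f,
    ← hprod, Finset.prod_eq_zero (Finset.mem_univ (x i)), smul_zero]
  have h1 : (Finset.univ.filter fun j => x j = x i) = {i} := by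
    ext j; simp [hx.eq_iff]
  have h2 : (Finset.univ.filter fun j => y j = x i) = ∅ := by
    ext j; simp [hi j]
  simp [h1, h2, hg]

end phaseMixture

/-- An injective tuple is a rearrangement of any tuple of the same length containing its
entries. -/
theorem exists_perm_of_injective_of_range_subset {β : Type*} {t : ℕ} {x y : Fin t → β}
    (hx : Function.Injective x) (hxy : ∀ i, ∃ j, y j = x i) :
    ∃ σ : Equiv.Perm (Fin t), y = x ∘ σ := by
  choose τ hτ using hxy
  have hτi : Function.Injective τ := fun a b hab => hx (by rw [← hτ a, ← hτ b, hab])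
  let e := Equiv.ofBijective τ (Finite.injective_iff_bijective.mp hτi)
  refine ⟨e.symm, funext fun j => ?_⟩
  rw [Function.comp_apply, ← hτ]
  exact congrArg y (e.apply_symm_apply j).symm

theorem phaseMixture_apply_eq_of_injective {n t : ℕ} {α β : Type} [Fintype α] [Fintype β]
    [Nonempty α] [Nonempty β] {g : α → ℂ} {k : β → ℂ}
    (hg : ∀ a, g a * (starRingEnd ℂ) (g a) = (2 ^ n : ℂ)⁻¹) (hg0 : ∑ a, g a = 0)
    (hk : ∀ b, k b * (starRingEnd ℂ) (k b) = (2 ^ n : ℂ)⁻¹) (hk0 : ∑ b, k b = 0)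
    {x : Tup n t} (hx : Function.Injective x) (y : Tup n t) :
    phaseMixture n t g x y = phaseMixture n t k x y := by
  by_cases hxy : ∀ i, ∃ j, y j = x i
  · obtain ⟨σ, rfl⟩ := exists_perm_of_injective_of_range_subset hx hxy
    rw [phaseMixture_apply_comp_perm hg, phaseMixture_apply_comp_perm hk]
  · push Not at hxy
    obtain ⟨i, hi⟩ := hxy
    rw [phaseMixture_apply_eq_zero hg0 hx hi, phaseMixture_apply_eq_zero hk0 hx hi]

/-- The diagonal projection onto the tuples with a repeated entry. -/
def collisionProj (n t : ℕ) : Matrix (Tup n t) (Tup n t) ℂ :=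
  Matrix.diagonal fun x => if Function.Injective x then 0 else 1

theorem collisionProj_conj_apply {n t : ℕ} (M : Matrix (Tup n t) (Tup n t) ℂ) (x y : Tup n t) :
    ((collisionProj n t).conjTranspose * M * collisionProj n t) x y =
      if Function.Injective x ∨ Function.Injective y then 0 else M x y := by
  rw [collisionProj, Matrix.diagonal_conjTranspose, Matrix.mul_diagonal, Matrix.diagonal_mul]
  by_cases hx : Function.Injective x <;> by_cases hy : Function.Injective y <;> simp [hx, hy]

theorem prod_one_sub_div_eq_descFactorial_div {N t : ℕ} (hN : N ≠ 0) (ht1 : 1 ≤ t)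
    (ht : t ≤ N) :
    ∏ i ∈ Finset.Icc 1 (t - 1), (1 - (i : ℝ) / N) = (N.descFactorial t : ℝ) / (N : ℝ) ^ t := by
  have hN' : (N : ℝ) ≠ 0 := Nat.cast_ne_zero.mpr hN
  have hrange : ∏ i ∈ Finset.Icc 1 (t - 1), (1 - (i : ℝ) / N) =
      ∏ i ∈ Finset.range t, (1 - (i : ℝ) / N) := by
    refine Finset.prod_subset (fun i hi => ?_) fun i hi hi' => ?_
    · simp only [Finset.mem_Icc, Finset.mem_range] at *; omega
    · simp only [Finset.mem_Icc, Finset.mem_range] at *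
      obtain rfl : i = 0 := by omega
      simp
  have hpow : (N : ℝ) ^ t = ∏ _i ∈ Finset.range t, (N : ℝ) := by simp
  rw [hrange, Nat.descFactorial_eq_prod_range, Nat.cast_prod, hpow, ← Finset.prod_div_distrib]
  refine Finset.prod_congr rfl fun i hi => ?_
  rw [Nat.cast_sub ((Finset.mem_range.mp hi).le.trans ht), sub_div, div_self hN']

theorem trace_collisionProj_conj_phaseMixture {n t : ℕ} (ht1 : 1 ≤ t) (ht : t ≤ 2 ^ n)
    {α : Type} [Fintype α] [Nonempty α] {g : α → ℂ}
    (hg : ∀ a, g a * (starRingEnd ℂ) (g a) = (2 ^ n : ℂ)⁻¹) :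
    ((collisionProj n t).conjTranspose * phaseMixture n t g * collisionProj n t).trace.re =
      1 - ∏ i ∈ Finset.Icc 1 (t - 1), (1 - (i : ℝ) / 2 ^ n) := by
  have hdiag (x : Tup n t) :
      (((collisionProj n t).conjTranspose * phaseMixture n t g * collisionProj n t) x x).re =
        (1 - if Function.Injective x then 1 else 0) * ((2 ^ n : ℝ)⁻¹) ^ t := by
    have h := phaseMixture_apply_comp_perm hg x (Equiv.refl _)
    rw [Equiv.coe_refl, Function.comp_id] at h
    simp only [collisionProj_conj_apply, or_self, h]
    split_ifs
    · simp
    · rw [sub_zero, one_mul, ← Complex.ofReal_re (((2 ^ n : ℝ)⁻¹) ^ t)]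
      push_cast
      rfl
  have hcard : (Finset.univ.filter fun x : Tup n t => Function.Injective x).card =
      (2 ^ n).descFactorial t := by
    rw [← Fintype.card_subtype,
      Fintype.card_congr (Equiv.subtypeInjectiveEquivEmbedding (Fin t) (Str n)),
      Fintype.card_embedding_eq]
    simp
  have hprod := prod_one_sub_div_eq_descFactorial_div (N := 2 ^ n) (by positivity) ht1 ht
  push_cast at hprod
  rw [Matrix.trace, Complex.re_sum]
  simp only [Matrix.diag_apply, hdiag]
  rw [← Finset.sum_mul, Finset.sum_sub_distrib, Finset.sum_boole, hcard, hprod]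
  have hpos : (2 ^ n : ℝ) ≠ 0 := by positivity
  simp only [Finset.sum_const, Finset.card_univ, Fintype.card_pi, Fintype.card_bool,
    Finset.prod_const, Fintype.card_fin, nsmul_eq_mul, mul_one]
  push_cast
  rw [inv_pow]
  field_simp

theorem phase_mul_conj (n : ℕ) {z : ℂ} (hz : ‖z‖ = 1) :
    (z / Real.sqrt (2 ^ n)) * (starRingEnd ℂ) (z / Real.sqrt (2 ^ n)) = (2 ^ n : ℂ)⁻¹ := by
  rw [Complex.mul_conj, Complex.normSq_eq_norm_sq, norm_div, hz, Complex.norm_real,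
    Real.norm_of_nonneg (Real.sqrt_nonneg _), div_pow, Real.sq_sqrt (by positivity)]
  push_cast
  rw [one_pow, one_div]

theorem sum_exp_div_sqrt_eq_zero {n : ℕ} (hn : 1 ≤ n) :
    ∑ a : Fin (2 ^ n),
      Complex.exp (2 * Real.pi * Complex.I * ((a : ℕ) : ℂ) / (2 ^ n)) / Real.sqrt (2 ^ n) = 0 := by
  have hprim := Complex.isPrimitiveRoot_exp (2 ^ n) (by positivity)
  have hsum := hprim.geom_sum_eq_zero (Nat.one_lt_two_pow (by omega))
  rw [← Fin.sum_univ_eq_sum_range (fun i => _ ^ i)] at hsum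
  rw [← Finset.sum_div, div_eq_zero_iff]
  left
  rw [← hsum]
  refine Finset.sum_congr rfl fun a _ => ?_
  rw [← Complex.exp_nat_mul]
  push_cast
  ring_nf

/-- For `n ≥ 1` and `1 ≤ t ≤ 2ⁿ - 1`,
`td(ρ_{(t,n,2)}, ρ_{(t,n,2ⁿ)}) ≤ ∏_{i=1}^{t-1}(1 + i/2ⁿ) - ∏_{i=1}^{t-1}(1 - i/2ⁿ)`. -/
theorem td_binary_complex_le (n t : ℕ) (hn : 1 ≤ n) (ht1 : 1 ≤ t) (ht2 : t ≤ 2 ^ n - 1)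
    (h : (rho2 n t - rhoC n t).IsHermitian) :
    (1 / 2 : ℝ) * ∑ i, |h.eigenvalues i| ≤
      (∏ i ∈ Finset.Icc 1 (t - 1), (1 + (i : ℝ) / 2 ^ n)) -
        ∏ i ∈ Finset.Icc 1 (t - 1), (1 - (i : ℝ) / 2 ^ n) := by
  let g : Bool → ℂ := fun b => (if b then (-1 : ℂ) else 1) / Real.sqrt (2 ^ n)
  let k : Fin (2 ^ n) → ℂ := fun a =>
    Complex.exp (2 * Real.pi * Complex.I * ((a : ℕ) : ℂ) / (2 ^ n)) / Real.sqrt (2 ^ n)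
  have hg : ∀ b, g b * (starRingEnd ℂ) (g b) = (2 ^ n : ℂ)⁻¹ := fun b =>
    phase_mul_conj n (by cases b <;> simp)
  have hk : ∀ a, k a * (starRingEnd ℂ) (k a) = (2 ^ n : ℂ)⁻¹ := fun a => by
    refine phase_mul_conj n ?_
    rw [← Complex.norm_exp_ofReal_mul_I (2 * Real.pi * (a : ℕ) / 2 ^ n)]
    congr 2
    push_cast
    ring
  have hg0 : ∑ b, g b = 0 := by rw [Fintype.sum_bool, ← add_div]; simp
  have hk0 : ∑ a, k a = 0 := sum_exp_div_sqrt_eq_zero hn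
  have h2 : rho2 n t = phaseMixture n t g := rfl
  have hC : rhoC n t = phaseMixture n t k := rfl
  have hzero : ∀ x y, Function.Injective x → (rho2 n t - rhoC n t) x y = 0 := fun x y hx => by
    rw [Matrix.sub_apply, h2, hC, phaseMixture_apply_eq_of_injective hg hg0 hk hk0 hx, sub_self]
  have hsplit : rho2 n t - rhoC n t =
      (collisionProj n t).conjTranspose * phaseMixture n t g * collisionProj n t -
        (collisionProj n t).conjTranspose * phaseMixture n t k * collisionProj n t := by
    ext x y
    rw [Matrix.sub_apply (_ * _), collisionProj_conj_apply, collisionProj_conj_apply]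
    split_ifs with hxy
    · rw [sub_self]
      rcases hxy with hx | hy
      · exact hzero x y hx
      · rw [← h.apply, hzero y x hy, star_zero]
    · rfl
  have hle := sum_abs_eigenvalues_le_of_eq_sub h
    (phaseMixture_posSemidef.conjTranspose_mul_mul_same _)
    (phaseMixture_posSemidef.conjTranspose_mul_mul_same _) hsplit
  have ht : t ≤ 2 ^ n := ht2.trans (Nat.sub_le _ _)
  rw [trace_collisionProj_conj_phaseMixture ht1 ht hg,
    trace_collisionProj_conj_phaseMixture ht1 ht hk] at hle
  have hone : 1 ≤ ∏ i ∈ Finset.Icc 1 (t - 1), (1 + (i : ℝ) / 2 ^ n) :=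
    Finset.one_le_prod fun i _ => le_add_of_nonneg_right (by positivity)
  linarith
end
end

section
/- For all natural numbers n ≥ 1 and 1 ≤ t ≤ 2ⁿ − 1, the number of non-zero eigenvalues (counted with multiplicity), equivalently the rank, of the difference matrix ρₙ := ρ_{(t,n,2)} − ρ_{(t,n,2ⁿ)} is at most C(2ⁿ + t − 1, t) − C(2ⁿ, t), where C(·,·) denotes the binomial coefficient. -/
open MeasureTheory
open scoped BigOperators Classical

noncomputable section

section

variable {ι Z B : Type*} [Fintype ι] [DecidableEq Z]

/-- The number of occurrences of `z` in the tuple `x`. -/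
def mult (x : ι → Z) (z : Z) : ℕ := (Finset.univ.filter fun i => x i = z).card

theorem mult_le_card (x : ι → Z) (z : Z) : mult x z ≤ Fintype.card ι :=
  Finset.card_le_univ _

theorem mult_le_one_of_injective {x : ι → Z} (hx : Function.Injective x) (z : Z) :
    mult x z ≤ 1 := by
  refine Finset.card_le_one.2 fun i hi j hj => hx ?_
  rw [(Finset.mem_filter.1 hi).2, (Finset.mem_filter.1 hj).2]

variable [Fintype Z] [Fintype B]

theorem prod_comp_eq_prod_pow_mult {M : Type*} [CommMonoid M] (x : ι → Z) (h : Z → M) :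
    ∏ i, h (x i) = ∏ z, h z ^ mult x z := by
  rw [← Finset.prod_fiberwise Finset.univ x]
  refine Finset.prod_congr rfl fun z _ => ?_
  rw [mult, ← Finset.prod_const]
  refine Finset.prod_congr rfl fun i hi => ?_
  rw [(Finset.mem_filter.1 hi).2]

theorem sum_mult (x : ι → Z) : ∑ z, mult x z = Fintype.card ι :=
  (Finset.card_eq_sum_card_fiberwise fun _ _ => Finset.mem_coe.2 (Finset.mem_univ _)).symm

/-- An injective tuple is determined, up to order, by the parities of its multiplicities among
all tuples of the same length. -/
theorem mult_eq_of_injective_of_even {x y : ι → Z} (hx : Function.Injective x)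
    (h : ∀ z, Even (mult x z + mult y z)) : mult x = mult y := by
  have hle : ∀ z ∈ Finset.univ, mult x z ≤ mult y z := fun z _ => by
    have h1 := mult_le_one_of_injective hx z
    obtain ⟨k, hk⟩ := h z
    omega
  have := (Finset.sum_eq_sum_iff_of_le hle).1 (by rw [sum_mult, sum_mult])
  exact funext fun z => this z (Finset.mem_univ z)

theorem sum_prod_mul_conj (g : B → ℂ) (x y : ι → Z) :
    ∑ f : Z → B, (∏ i, g (f (x i))) * (starRingEnd ℂ) (∏ i, g (f (y i))) =
      ∏ z, ∑ b, g b ^ mult x z * (starRingEnd ℂ) (g b) ^ mult y z := by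
  rw [Finset.prod_univ_sum, Fintype.piFinset_univ]
  refine Finset.sum_congr rfl fun f _ => ?_
  rw [prod_comp_eq_prod_pow_mult x fun z => g (f z),
    prod_comp_eq_prod_pow_mult y fun z => g (f z), map_prod, ← Finset.prod_mul_distrib]
  simp only [map_pow]

theorem sum_prod_mul_conj_of_mult_eq [Nonempty B] {g : B → ℂ} {r : ℂ}
    (hg : ∀ b, g b * (starRingEnd ℂ) (g b) = r) {x y : ι → Z} (hxy : mult x = mult y) :
    (Fintype.card (Z → B) : ℂ)⁻¹ *
        ∑ f : Z → B, (∏ i, g (f (x i))) * (starRingEnd ℂ) (∏ i, g (f (y i))) =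
      ∏ z, r ^ mult x z := by
  rw [sum_prod_mul_conj, ← hxy]
  simp only [← mul_pow, hg, Finset.sum_const, nsmul_eq_mul, Finset.prod_mul_distrib,
    Finset.prod_const, Fintype.card_fun, Nat.cast_pow, Finset.card_univ]
  rw [inv_mul_cancel_left₀]
  exact pow_ne_zero _ (Nat.cast_ne_zero.2 Fintype.card_ne_zero)

theorem sum_prod_mul_conj_of_sum_eq_zero {g : B → ℂ} {x y : ι → Z} {z : Z}
    (hz : ∑ b, g b ^ mult x z * (starRingEnd ℂ) (g b) ^ mult y z = 0) :
    ∑ f : Z → B, (∏ i, g (f (x i))) * (starRingEnd ℂ) (∏ i, g (f (y i))) = 0 := by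
  rw [sum_prod_mul_conj]
  exact Finset.prod_eq_zero (Finset.mem_univ z) hz

end

/-- The amplitude `(-1)^b / √(2ⁿ)`. -/
def amp2 (n : ℕ) (b : Bool) : ℂ := (if b then (-1 : ℂ) else 1) / Real.sqrt (2 ^ n)

/-- The amplitude `ω^b / √(2ⁿ)`. -/
def ampC (n : ℕ) (b : Fin (2 ^ n)) : ℂ :=
  Complex.exp (2 * Real.pi * Complex.I * ((b : ℕ) : ℂ) / (2 ^ n)) / Real.sqrt (2 ^ n)

theorem sqrt_two_pow_mul_self (n : ℕ) :
    ((Real.sqrt (2 ^ n) : ℝ) : ℂ) * (Real.sqrt (2 ^ n) : ℝ) = 2 ^ n := by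
  rw [← Complex.ofReal_mul, Real.mul_self_sqrt (by positivity)]
  push_cast
  rfl

theorem amp2_mul_conj (n : ℕ) (b : Bool) :
    amp2 n b * (starRingEnd ℂ) (amp2 n b) = 1 / 2 ^ n := by
  rw [← sqrt_two_pow_mul_self]
  cases b <;> simp [amp2, div_mul_div_comm]

theorem ampC_eq (n : ℕ) (b : Fin (2 ^ n)) :
    ampC n b =
      Complex.exp (2 * Real.pi * Complex.I / (2 ^ n : ℕ)) ^ (b : ℕ) / Real.sqrt (2 ^ n) := by
  rw [ampC, ← Complex.exp_nat_mul]
  congr 2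
  push_cast
  ring

theorem exp_mul_conj_exp (N : ℕ) :
    Complex.exp (2 * Real.pi * Complex.I / N) *
      (starRingEnd ℂ) (Complex.exp (2 * Real.pi * Complex.I / N)) = 1 := by
  rw [← Complex.exp_conj, ← Complex.exp_add, Complex.exp_eq_one_iff]
  exact ⟨0, by simp [neg_div, Complex.conj_ofNat]⟩

theorem ampC_mul_conj (n : ℕ) (b : Fin (2 ^ n)) :
    ampC n b * (starRingEnd ℂ) (ampC n b) = 1 / 2 ^ n := by
  rw [← sqrt_two_pow_mul_self, ampC_eq, map_div₀, map_pow, Complex.conj_ofReal, div_mul_div_comm,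
    ← mul_pow, exp_mul_conj_exp, one_pow]

theorem sum_amp2_eq_zero (n : ℕ) {a c : ℕ} (h : ¬ Even (a + c)) :
    ∑ b, amp2 n b ^ a * (starRingEnd ℂ) (amp2 n b) ^ c = 0 := by
  have h1 : (-1 : ℂ) ^ a * (-1) ^ c = -1 := by
    rw [← pow_add]
    exact (Nat.not_even_iff_odd.1 h).neg_one_pow
  simp only [amp2, Fintype.sum_bool, map_div₀, Complex.conj_ofReal, if_true, map_neg, map_one,
    Bool.false_eq_true, if_false, div_pow, one_pow, div_mul_div_comm, h1]
  ring

theorem sum_ampC_eq_zero (n : ℕ) {a c : ℕ} (ha : a < 2 ^ n) (hc : c < 2 ^ n) (h : a ≠ c) :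
    ∑ b, ampC n b ^ a * (starRingEnd ℂ) (ampC n b) ^ c = 0 := by
  set ζ := Complex.exp (2 * Real.pi * Complex.I / (2 ^ n : ℕ)) with hζ
  have hprim : IsPrimitiveRoot ζ (2 ^ n) := Complex.isPrimitiveRoot_exp _ (by positivity)
  have hconj : ζ * (starRingEnd ℂ) ζ = 1 := exp_mul_conj_exp _
  set w := ζ ^ a * (starRingEnd ℂ) ζ ^ c with hw
  have hw1 : w ≠ 1 := fun h1 => h <| hprim.pow_inj ha hc <| by
    calc ζ ^ a = ζ ^ a * (ζ * (starRingEnd ℂ) ζ) ^ c := by rw [hconj, one_pow, mul_one]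
      _ = w * ζ ^ c := by rw [hw]; ring
      _ = ζ ^ c := by rw [h1, one_mul]
  have hwN : w ^ 2 ^ n = 1 := by
    rw [hw, mul_pow, ← pow_mul, ← pow_mul, mul_comm a, mul_comm c, pow_mul, pow_mul, ← map_pow,
      hprim.pow_eq_one, map_one, one_pow, one_pow, one_mul]
  have hgeom : ∑ b : Fin (2 ^ n), w ^ (b : ℕ) = 0 := by
    rw [Fin.sum_univ_eq_sum_range (fun k => w ^ k) (2 ^ n)]
    have := geom_sum_mul w (2 ^ n)
    rw [hwN, sub_self] at this
    exact (mul_eq_zero.1 this).resolve_right (sub_ne_zero.2 hw1)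
  have hterm : ∀ b : Fin (2 ^ n), ampC n b ^ a * (starRingEnd ℂ) (ampC n b) ^ c =
      w ^ (b : ℕ) * (((Real.sqrt (2 ^ n) : ℝ) : ℂ) ^ (a + c))⁻¹ := fun b => by
    rw [ampC_eq, ← hζ, map_div₀, map_pow, Complex.conj_ofReal, hw, div_pow, div_pow,
      div_mul_div_comm, ← pow_add, div_eq_mul_inv]
    ring
  rw [Finset.sum_congr rfl fun b _ => hterm b, ← Finset.sum_mul, hgeom, zero_mul]

theorem rho2_apply (n t : ℕ) (x y : Tup n t) :
    rho2 n t x y = (Fintype.card (Str n → Bool) : ℂ)⁻¹ * ∑ f : Str n → Bool,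
      (∏ i, amp2 n (f (x i))) * (starRingEnd ℂ) (∏ i, amp2 n (f (y i))) := by
  simp only [rho2, Matrix.smul_apply, Matrix.sum_apply, smul_eq_mul]
  rfl

theorem rhoC_apply (n t : ℕ) (x y : Tup n t) :
    rhoC n t x y = (Fintype.card (Str n → Fin (2 ^ n)) : ℂ)⁻¹ * ∑ f : Str n → Fin (2 ^ n),
      (∏ i, ampC n (f (x i))) * (starRingEnd ℂ) (∏ i, ampC n (f (y i))) := by
  simp only [rhoC, Matrix.smul_apply, Matrix.sum_apply, smul_eq_mul]
  rfl

theorem rho_diff_apply_of_injective {n t : ℕ} (ht : t < 2 ^ n) {x : Tup n t}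
    (hx : Function.Injective x) (y : Tup n t) : (rho2 n t - rhoC n t) x y = 0 := by
  rw [Matrix.sub_apply, rho2_apply, rhoC_apply, sub_eq_zero]
  by_cases hxy : mult x = mult y
  · rw [sum_prod_mul_conj_of_mult_eq (amp2_mul_conj n) hxy,
      sum_prod_mul_conj_of_mult_eq (ampC_mul_conj n) hxy]
  · obtain ⟨z, hz⟩ := not_forall.1 (mt (mult_eq_of_injective_of_even hx) hxy)
    have hlt : ∀ (u : Tup n t) (z : Str n), mult u z < 2 ^ n := fun u z =>
      (mult_le_card u z).trans_lt (by simpa using ht)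
    obtain ⟨z', hz'⟩ := Function.ne_iff.1 hxy
    rw [sum_prod_mul_conj_of_sum_eq_zero (sum_amp2_eq_zero n hz),
      sum_prod_mul_conj_of_sum_eq_zero (sum_ampC_eq_zero n (hlt x z') (hlt y z') hz'),
      mul_zero, mul_zero]

/-- The unordered tuple underlying a tuple. -/
def tupType {n t : ℕ} (x : Tup n t) : Sym (Str n) t :=
  ⟨Finset.univ.val.map x, by simp⟩

theorem prod_eq_of_tupType_eq {n t : ℕ} {x x' : Tup n t} (h : tupType x = tupType x')
    (v : Str n → ℂ) : ∏ i, v (x i) = ∏ i, v (x' i) := by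
  have h' := congrArg (fun s : Sym (Str n) t => ((s : Multiset (Str n)).map v).prod) h
  simpa [tupType, Finset.prod, Function.comp_def] using h'

theorem rho_diff_apply_congr {n t : ℕ} {x x' : Tup n t} (h : tupType x = tupType x')
    (y : Tup n t) : (rho2 n t - rhoC n t) x y = (rho2 n t - rhoC n t) x' y := by
  simp only [Matrix.sub_apply, rho2, rhoC, Matrix.smul_apply, Matrix.sum_apply, outerT,
    Matrix.of_apply, prod_eq_of_tupType_eq h]

/-- Unordered tuples with a repeated entry. -/
abbrev RepeatedSym (n t : ℕ) := {s : Sym (Str n) t // ¬ (s : Multiset (Str n)).Nodup}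

theorem card_repeatedSym_le (n t : ℕ) :
    Fintype.card (RepeatedSym n t) ≤ (2 ^ n + t - 1).choose t - (2 ^ n).choose t := by
  have hStr : Fintype.card (Str n) = 2 ^ n := by simp
  have hle : (2 ^ n).choose t ≤
      Fintype.card {s : Sym (Str n) t // (s : Multiset (Str n)).Nodup} := by
    rw [← hStr, ← Finset.card_univ, ← Finset.card_powersetCard, ← Fintype.card_coe]
    refine Fintype.card_le_of_injective
      (fun S => ⟨⟨S.1.val, (Finset.mem_powersetCard.1 S.2).2⟩, S.1.nodup⟩) fun S S' h => ?_
    exact Subtype.ext (Finset.val_injective (congrArg (fun s => (s.1 : Multiset (Str n))) h))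
  rw [Fintype.card_subtype_compl, Sym.card_sym_eq_choose, hStr]
  exact Nat.sub_le_sub_left hle _

/-- A matrix whose rows depend only on a label, and vanish unless the label is in the range of an
index set `K`, has rank at most the size of `K`. -/
theorem rank_le_card_of_rows {X L K : Type*} [Fintype X] [Fintype K] (M : Matrix X X ℂ)
    (τ : X → L) (e : K → L) (he : Function.Injective e)
    (hM : ∀ x x', τ x = τ x' → M x = M x') (h0 : ∀ x, τ x ∉ Set.range e → M x = 0) :
    M.rank ≤ Fintype.card K := by
  have hfac : M = (Matrix.of fun x k => if τ x = e k then (1 : ℂ) else 0) *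
      (Matrix.of fun k y => if hk : ∃ x, τ x = e k then M hk.choose y else 0 :
        Matrix K X ℂ) := by
    ext x y
    rw [Matrix.mul_apply]
    by_cases hx : τ x ∈ Set.range e
    · obtain ⟨k, hk⟩ := hx
      rw [Finset.sum_eq_single k]
      · have hex : ∃ x', τ x' = e k := ⟨x, hk.symm⟩
        simp only [Matrix.of_apply, if_pos hk.symm, dif_pos hex, one_mul]
        exact congrFun (hM _ _ (hk.symm.trans hex.choose_spec.symm)) y
      · intro k' _ hne
        simp only [Matrix.of_apply]
        rw [if_neg fun h => hne (he (h.symm.trans hk.symm)), zero_mul]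
      · exact fun h => absurd (Finset.mem_univ k) h
    · rw [h0 x hx, Finset.sum_eq_zero, Pi.zero_apply]
      intro k _
      simp only [Matrix.of_apply]
      rw [if_neg fun h => hx ⟨k, h.symm⟩, zero_mul]
  rw [hfac]
  exact (Matrix.rank_mul_le_left _ _).trans (Matrix.rank_le_card_width _)

theorem injective_of_nodup_tupType {n t : ℕ} {x : Tup n t}
    (h : (tupType x : Multiset (Str n)).Nodup) : Function.Injective x := fun i j hij =>
  Multiset.inj_on_of_nodup_map (f := x) (s := Finset.univ.val) h i (Finset.mem_univ i) j (Finset.mem_univ j) hij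

/-- For `n ≥ 1` and `1 ≤ t ≤ 2ⁿ - 1`, the number of non-zero eigenvalues
(with multiplicity) of `ρₙ = ρ_{(t,n,2)} - ρ_{(t,n,2ⁿ)}`, equivalently its rank, is at most
`C(2ⁿ + t - 1, t) - C(2ⁿ, t)`. -/
theorem rank_rho_diff_le (n t : ℕ) (hn : 1 ≤ n) (ht1 : 1 ≤ t) (ht2 : t ≤ 2 ^ n - 1)
    (h : (rho2 n t - rhoC n t).IsHermitian) :
    (Finset.univ.filter fun i => h.eigenvalues i ≠ 0).card ≤
        (2 ^ n + t - 1).choose t - (2 ^ n).choose t ∧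
      (rho2 n t - rhoC n t).rank ≤ (2 ^ n + t - 1).choose t - (2 ^ n).choose t := by
  have hrank : (rho2 n t - rhoC n t).rank ≤ (2 ^ n + t - 1).choose t - (2 ^ n).choose t := by
    refine (rank_le_card_of_rows _ tupType (Subtype.val : RepeatedSym n t → _)
      Subtype.val_injective (fun x x' h => funext (rho_diff_apply_congr h)) fun x hx => ?_).trans
      (card_repeatedSym_le n t)
    have hnodup : (tupType x : Multiset (Str n)).Nodup := by
      by_contra hnot
      exact hx ⟨⟨tupType x, hnot⟩, rfl⟩
    exact funext (rho_diff_apply_of_injective (by omega) (injective_of_nodup_tupType hnodup))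
  refine ⟨?_, hrank⟩
  rw [← Fintype.card_subtype, ← h.rank_eq_card_non_zero_eigs]
  exact hrank
end
end

section
/- For all natural numbers n ≥ 1 and 1 ≤ t ≤ 2ⁿ − 1, the entries of the difference matrix ρₙ := ρ_{(t,n,2)} − ρ_{(t,n,2ⁿ)} are given by: for all tuples x, y ∈ ({0,1}ⁿ)ᵗ, ρₙ[x,y] = 2^{−tn} if x and y are remote stabilizations of each other, and ρₙ[x,y] = 0 otherwise. -/
open MeasureTheory
open scoped BigOperators Classical

noncomputable section

/-- Tuples `x, y ∈ ({0,1}ⁿ)ᵗ` are permutations of each other: some `π ∈ S_t` maps one to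
the other (equivalently, the multisets of their entries coincide). -/
def IsPerm (n t : ℕ) (x y : Tup n t) : Prop :=
  ∃ π : Equiv.Perm (Fin t), ∀ i, x i = y (π i)

/-- Tuples `x, y ∈ ({0,1}ⁿ)ᵗ` are stabilizations of each other: every string `s ∈ {0,1}ⁿ`
occurs an even number of times in the concatenated tuple `(x₁,…,x_t,y₁,…,y_t)`. -/
def IsStab (n t : ℕ) (x y : Tup n t) : Prop :=
  ∀ s : Str n, Even ((Finset.univ.filter fun i => x i = s).card +
    (Finset.univ.filter fun i => y i = s).card)

/-- `x, y` are remote stabilizations of each other: stabilizations but not permutations. -/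
def IsRemoteStab (n t : ℕ) (x y : Tup n t) : Prop :=
  IsStab n t x y ∧ ¬ IsPerm n t x y

/-- The number of occurrences of `s` in the tuple `x`. -/
def occ {n t : ℕ} (x : Tup n t) (s : Str n) : ℕ :=
  (Finset.univ.filter fun i => x i = s).card

lemma occ_le {n t : ℕ} (x : Tup n t) (s : Str n) : occ x s ≤ t :=
  (Finset.card_le_univ _).trans_eq (Fintype.card_fin t)

lemma prod_comp_eq_prod_pow_occ {n t : ℕ} (x : Tup n t) (h : Str n → ℂ) :
    ∏ i, h (x i) = ∏ s, h s ^ occ x s := by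
  rw [← Finset.prod_fiberwise' Finset.univ x h]
  exact Finset.prod_congr rfl fun s _ => by rw [Finset.prod_const]; unfold occ; congr!

lemma isPerm_iff_occ_eq {n t : ℕ} (x y : Tup n t) :
    IsPerm n t x y ↔ ∀ s, occ x s = occ y s := by
  constructor
  · rintro ⟨π, hπ⟩ s
    refine Finset.card_bij (fun i _ => π i) ?_ (fun _ _ _ _ h => π.injective h) ?_
    · intro i hi
      simpa [← hπ i] using hi
    · intro j hj
      refine ⟨π.symm j, ?_, by simp⟩
      simpa [hπ] using hj
  · intro h
    have e : ∀ s, {i // x i = s} ≃ {i // y i = s} := fun s =>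
      Fintype.equivOfCardEq (by
        rw [Fintype.card_subtype, Fintype.card_subtype]
        exact h s)
    refine ⟨(Equiv.sigmaFiberEquiv x).symm.trans
      ((Equiv.sigmaCongrRight e).trans (Equiv.sigmaFiberEquiv y)), fun i => ?_⟩
    exact (e (x i) ⟨i, rfl⟩).2.symm

/-- Entries of the averaged tensor power of a random phase state whose single-string moments
are indicators of a condition `P`; here `Q` stands for `P` holding at every string. -/
lemma average_outerT_apply {K : Type*} [Fintype K] {n t : ℕ} (g : K → ℂ) (x y : Tup n t)
    (P : Str n → Prop) (Q : Prop) (hQ : Q ↔ ∀ s, P s)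
    (hP : ∀ s, (Fintype.card K : ℂ)⁻¹ * ∑ k, g k ^ occ x s * (starRingEnd ℂ) (g k) ^ occ y s =
      if P s then 1 else 0) :
    ((Fintype.card (Str n → K) : ℂ)⁻¹ •
      ∑ f : Str n → K, outerT n t (fun z => g (f z) / Real.sqrt (2 ^ n))) x y =
      if Q then ((2 : ℂ) ^ (t * n))⁻¹ else 0 := by
  have hsqrt : ((Real.sqrt (2 ^ n) : ℝ) : ℂ) * ((Real.sqrt (2 ^ n) : ℝ) : ℂ) = 2 ^ n := by
    rw [← Complex.ofReal_mul, Real.mul_self_sqrt (by positivity)]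
    push_cast
    rfl
  have hterm : ∀ f : Str n → K, outerT n t (fun z => g (f z) / Real.sqrt (2 ^ n)) x y =
      ((2 : ℂ) ^ (t * n))⁻¹ *
        ∏ s, (g (f s) ^ occ x s * (starRingEnd ℂ) (g (f s)) ^ occ y s) := by
    intro f
    simp only [outerT, Matrix.of_apply, map_prod, map_div₀, map_pow, Complex.conj_ofReal,
      Finset.prod_div_distrib, Finset.prod_const, Finset.card_univ, Fintype.card_fin]
    rw [prod_comp_eq_prod_pow_occ x fun s => g (f s),
      prod_comp_eq_prod_pow_occ y fun s => (starRingEnd ℂ) (g (f s)),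
      div_mul_div_comm, ← mul_pow, hsqrt, ← pow_mul, mul_comm n t, Finset.prod_mul_distrib,
      div_eq_inv_mul]
  have hsum : ∑ f : Str n → K, ∏ s, (g (f s) ^ occ x s * (starRingEnd ℂ) (g (f s)) ^ occ y s) =
      ∏ s, ∑ k, g k ^ occ x s * (starRingEnd ℂ) (g k) ^ occ y s :=
    (Fintype.prod_sum fun s k => g k ^ occ x s * (starRingEnd ℂ) (g k) ^ occ y s).symm
  have hcard : (Fintype.card (Str n → K) : ℂ)⁻¹ = ∏ _s : Str n, (Fintype.card K : ℂ)⁻¹ := by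
    simp
  rw [Matrix.smul_apply, Matrix.sum_apply, Finset.sum_congr rfl fun f _ => hterm f,
    ← Finset.mul_sum, hsum, smul_eq_mul, mul_left_comm, hcard, ← Finset.prod_mul_distrib,
    Finset.prod_congr rfl fun s _ => hP s]
  by_cases h : Q
  · simp [h, hQ.mp h]
  · obtain ⟨s, hs⟩ := not_forall.mp (mt hQ.mpr h)
    rw [if_neg h, Finset.prod_eq_zero (Finset.mem_univ s) (if_neg hs), mul_zero]

lemma sign_moment (a b : ℕ) :
    (Fintype.card Bool : ℂ)⁻¹ * ∑ k : Bool, (if k then (-1 : ℂ) else 1) ^ a *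
      (starRingEnd ℂ) (if k then (-1 : ℂ) else 1) ^ b = if Even (a + b) then 1 else 0 := by
  by_cases h : Even (a + b)
  · simp [h, ← pow_add, one_add_one_eq_two]
  · simp [h, ← pow_add, (Nat.not_even_iff_odd.mp h).neg_one_pow]

lemma root_of_unity_moment {N : ℕ} (a b : ℕ) (ha : a < N) (hb : b < N) :
    (Fintype.card (Fin N) : ℂ)⁻¹ *
      ∑ k : Fin N, Complex.exp (2 * Real.pi * Complex.I * ((k : ℕ) : ℂ) / N) ^ a *
        (starRingEnd ℂ) (Complex.exp (2 * Real.pi * Complex.I * ((k : ℕ) : ℂ) / N)) ^ b =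
      if a = b then 1 else 0 := by
  have hN : N ≠ 0 := by omega
  have hN' : (N : ℂ) ≠ 0 := Nat.cast_ne_zero.mpr hN
  set ζ : ℂ := Complex.exp (2 * Real.pi * Complex.I / N) with hζ
  have hprim : IsPrimitiveRoot ζ N := Complex.isPrimitiveRoot_exp N hN
  have hζ0 : ζ ≠ 0 := Complex.exp_ne_zero _
  have hconj : (starRingEnd ℂ) ζ = ζ⁻¹ := (Complex.inv_eq_conj (hprim.norm'_eq_one hN)).symm
  have hterm : ∀ k : Fin N,
      Complex.exp (2 * Real.pi * Complex.I * ((k : ℕ) : ℂ) / N) ^ a *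
        (starRingEnd ℂ) (Complex.exp (2 * Real.pi * Complex.I * ((k : ℕ) : ℂ) / N)) ^ b =
      (ζ ^ ((a : ℤ) - b)) ^ (k : ℕ) := by
    intro k
    have hk : Complex.exp (2 * Real.pi * Complex.I * ((k : ℕ) : ℂ) / N) = ζ ^ (k : ℕ) := by
      rw [hζ, ← Complex.exp_nat_mul]
      congr 1
      ring
    rw [hk, map_pow, hconj, zpow_sub₀ hζ0, zpow_natCast, zpow_natCast, div_eq_mul_inv, mul_pow,
      ← inv_pow, pow_right_comm, pow_right_comm ζ⁻¹]
  rw [Finset.sum_congr rfl fun k _ => hterm k,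
    Fin.sum_univ_eq_sum_range (fun k => (ζ ^ ((a : ℤ) - b)) ^ k) N]
  by_cases h : a = b
  · simp [h, hN']
  · have hne : ζ ^ ((a : ℤ) - b) ≠ 1 := by
      rw [Ne, hprim.zpow_eq_one_iff_dvd]
      intro hd
      have := Int.eq_zero_of_abs_lt_dvd hd (abs_lt.mpr ⟨by omega, by omega⟩)
      omega
    have hpow : (ζ ^ ((a : ℤ) - b)) ^ N = 1 := by
      rw [← zpow_natCast, ← zpow_mul, mul_comm, zpow_mul, zpow_natCast, hprim.pow_eq_one, one_zpow]
    rw [geom_sum_eq hne, hpow, sub_self, zero_div, mul_zero, if_neg h]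

lemma rho2_apply_s5 {n t : ℕ} (x y : Tup n t) :
    rho2 n t x y = if IsStab n t x y then ((2 : ℂ) ^ (t * n))⁻¹ else 0 :=
  average_outerT_apply (fun k : Bool => if k then (-1 : ℂ) else 1) x y
    (fun s => Even (occ x s + occ y s)) _ Iff.rfl fun s => by convert sign_moment (occ x s) (occ y s)

lemma rhoC_apply_s5 {n t : ℕ} (ht : t < 2 ^ n) (x y : Tup n t) :
    rhoC n t x y = if IsPerm n t x y then ((2 : ℂ) ^ (t * n))⁻¹ else 0 := by
  refine average_outerT_apply (fun k : Fin (2 ^ n) =>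
    Complex.exp (2 * Real.pi * Complex.I * ((k : ℕ) : ℂ) / (2 ^ n))) x y
    (fun s => occ x s = occ y s) _ (isPerm_iff_occ_eq x y) fun s => ?_
  have h := root_of_unity_moment (occ x s) (occ y s) ((occ_le x s).trans_lt ht)
    ((occ_le y s).trans_lt ht)
  push_cast at h
  convert h

lemma IsPerm.isStab {n t : ℕ} {x y : Tup n t} (h : IsPerm n t x y) : IsStab n t x y := by
  intro s
  change Even (occ x s + occ y s)
  rw [(isPerm_iff_occ_eq x y).mp h s]
  exact Even.add_self _

/-- For `n ≥ 1` and `1 ≤ t ≤ 2ⁿ - 1`, the entries of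
`ρₙ = ρ_{(t,n,2)} - ρ_{(t,n,2ⁿ)}` are `2^{-tn}` at `(x, y)` with `x, y` remote stabilizations
of each other, and `0` otherwise. -/
theorem rho_diff_entries (n t : ℕ) (hn : 1 ≤ n) (ht1 : 1 ≤ t) (ht2 : t ≤ 2 ^ n - 1)
    (x y : Tup n t) :
    (rho2 n t - rhoC n t) x y =
      if IsRemoteStab n t x y then ((2 : ℂ) ^ (t * n))⁻¹ else 0 := by
  have ht : t < 2 ^ n := by have := Nat.two_pow_pos n; omega
  rw [Matrix.sub_apply, rho2_apply_s5, rhoC_apply_s5 ht]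
  by_cases hp : IsPerm n t x y
  · simp [IsRemoteStab, hp, hp.isStab]
  · simp [IsRemoteStab, hp]
end
end

section
/- For all natural numbers n ≥ 1 and 1 ≤ t ≤ 2ⁿ − 1, the entries of the t-copy random complex phase mixed state are given by: for all tuples x, y ∈ ({0,1}ⁿ)ᵗ, ρ_{(t,n,2ⁿ)}[x,y] = 2^{−tn} if x and y are permutations of each other, and ρ_{(t,n,2ⁿ)}[x,y] = 0 otherwise. -/
open MeasureTheory
open scoped BigOperators Classical

noncomputable section

/-- Orthogonality of the characters `k ↦ ζ ^ (k * a)` of `ℤ/Nℤ`, for exponents below `N`. -/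
lemma IsPrimitiveRoot.sum_pow_mul_conj_pow {N : ℕ} {ζ : ℂ} (hζ : IsPrimitiveRoot ζ N)
    {a b : ℕ} (ha : a < N) (hb : b < N) :
    ∑ k : Fin N, (ζ ^ (k : ℕ)) ^ a * (starRingEnd ℂ) ((ζ ^ (k : ℕ)) ^ b) =
      if a = b then (N : ℂ) else 0 := by
  have hN : N ≠ 0 := by omega
  have hζ0 : ζ ≠ 0 := hζ.ne_zero hN
  have hterm (k : ℕ) : (ζ ^ k) ^ a * (starRingEnd ℂ) ((ζ ^ k) ^ b) = (ζ ^ a / ζ ^ b) ^ k := by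
    rw [map_pow, map_pow, ← Complex.inv_eq_conj (hζ.norm'_eq_one hN), div_eq_mul_inv, mul_pow,
      ← inv_pow, ← pow_mul, ← pow_mul, ← pow_mul, ← pow_mul, mul_comm k a, mul_comm k b]
  simp_rw [hterm]
  rw [Fin.sum_univ_eq_sum_range fun k => (ζ ^ a / ζ ^ b) ^ k]
  split_ifs with hab
  · simp [hab, div_self (pow_ne_zero b hζ0)]
  · have hne : ζ ^ a / ζ ^ b ≠ 1 := fun h =>
      hab (hζ.pow_inj ha hb (eq_of_div_eq_one h))
    rw [geom_sum_eq hne, div_pow, ← pow_mul, ← pow_mul, mul_comm a, mul_comm b, pow_mul,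
      pow_mul, hζ.pow_eq_one]
    simp

lemma isPerm_iff_card_filter_eq (n t : ℕ) (x y : Tup n t) :
    IsPerm n t x y ↔ ∀ s : Str n,
      (Finset.univ.filter fun i => x i = s).card = (Finset.univ.filter fun i => y i = s).card := by
  constructor
  · rintro ⟨π, hπ⟩ s
    exact Finset.card_equiv π fun i => by simp [hπ]
  · intro h
    have e (s : Str n) : {i // x i = s} ≃ {i // y i = s} :=
      Fintype.equivOfCardEq (by simpa only [Fintype.card_subtype] using h s)
    exact ⟨Equiv.ofFiberEquiv e, fun i => (Equiv.ofFiberEquiv_map e i).symm⟩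

lemma prod_comp_eq_prod_pow_card_filter {n t : ℕ} (x : Tup n t) (g : Str n → ℂ) :
    ∏ i, g (x i) = ∏ s, g s ^ (Finset.univ.filter fun i => x i = s).card := by
  rw [← Finset.prod_fiberwise' Finset.univ x g]
  simp only [Finset.prod_const]

lemma ketC_apply (n : ℕ) (f : Str n → Fin (2 ^ n)) (s : Str n) :
    ketC n f s =
      Complex.exp (2 * Real.pi * Complex.I / (2 ^ n : ℕ)) ^ (f s : ℕ) / Real.sqrt (2 ^ n) := by
  rw [ketC, ← Complex.exp_nat_mul]
  push_cast
  ring_nf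

lemma outerT_ketC_apply (n t : ℕ) (f : Str n → Fin (2 ^ n)) (x y : Tup n t) :
    outerT n t (ketC n f) x y = ((2 : ℂ) ^ (t * n))⁻¹ * ∏ s : Str n,
      ((Complex.exp (2 * Real.pi * Complex.I / (2 ^ n : ℕ)) ^ (f s : ℕ)) ^
          (Finset.univ.filter fun i => x i = s).card *
        (starRingEnd ℂ) ((Complex.exp (2 * Real.pi * Complex.I / (2 ^ n : ℕ)) ^ (f s : ℕ)) ^
          (Finset.univ.filter fun i => y i = s).card)) := by
  have hsqrt : ((Real.sqrt (2 ^ n) : ℝ) : ℂ) * (Real.sqrt (2 ^ n) : ℝ) = 2 ^ n := by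
    rw [← Complex.ofReal_mul, Real.mul_self_sqrt (by positivity)]
    push_cast
    rfl
  simp only [outerT, Matrix.of_apply, ketC_apply, Finset.prod_div_distrib, Finset.prod_const,
    Finset.card_univ, Fintype.card_fin, map_div₀, Finset.prod_mul_distrib]
  rw [prod_comp_eq_prod_pow_card_filter x fun s => _ ^ (f s : ℕ),
    prod_comp_eq_prod_pow_card_filter y fun s => _ ^ (f s : ℕ), map_pow, Complex.conj_ofReal,
    div_mul_div_comm, ← mul_pow, hsqrt, ← pow_mul, mul_comm n t, div_eq_inv_mul, map_prod]

/-- For `n ≥ 1` and `1 ≤ t ≤ 2ⁿ - 1`, the entries of `ρ_{(t,n,2ⁿ)}` are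
`2^{-tn}` at `(x, y)` with `x, y` permutations of each other, and `0` otherwise. -/
theorem rhoC_entries (n t : ℕ) (hn : 1 ≤ n) (ht1 : 1 ≤ t) (ht2 : t ≤ 2 ^ n - 1)
    (x y : Tup n t) :
    rhoC n t x y = if IsPerm n t x y then ((2 : ℂ) ^ (t * n))⁻¹ else 0 := by
  have hlt (z : Tup n t) (s : Str n) :
      (Finset.univ.filter fun i => z i = s).card < 2 ^ n := by
    have hle := Finset.card_le_univ (Finset.univ.filter fun i => z i = s)
    rw [Fintype.card_fin] at hle
    have := Nat.two_pow_pos n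
    omega
  have hζ := Complex.isPrimitiveRoot_exp (2 ^ n) (by positivity)
  simp only [rhoC, Matrix.smul_apply, Matrix.sum_apply, smul_eq_mul, outerT_ketC_apply]
  rw [← Finset.mul_sum, ← Fintype.prod_sum fun (s : Str n) (k : Fin (2 ^ n)) =>
    (Complex.exp (2 * Real.pi * Complex.I / (2 ^ n : ℕ)) ^ (k : ℕ)) ^
        (Finset.univ.filter fun i => x i = s).card *
      (starRingEnd ℂ) ((Complex.exp (2 * Real.pi * Complex.I / (2 ^ n : ℕ)) ^ (k : ℕ)) ^
        (Finset.univ.filter fun i => y i = s).card)]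
  simp_rw [hζ.sum_pow_mul_conj_pow (hlt x _) (hlt y _)]
  split_ifs with h
  · rw [isPerm_iff_card_filter_eq] at h
    simp only [h, if_true, Finset.prod_const, Finset.card_univ, Fintype.card_fun,
      Fintype.card_fin, Fintype.card_bool]
    push_cast
    field_simp
  · rw [isPerm_iff_card_filter_eq, not_forall] at h
    obtain ⟨s, hs⟩ := h
    rw [Finset.prod_eq_zero (Finset.mem_univ s) (if_neg hs), mul_zero, mul_zero]
end
end

section
/- For all natural numbers n ≥ 1 and t ≥ 1, the entries of the t-copy random binary phase mixed state are given by: for all tuples x, y ∈ ({0,1}ⁿ)ᵗ, ρ_{(t,n,2)}[x,y] = 2^{−tn} if x and y are stabilizations of each other, and ρ_{(t,n,2)}[x,y] = 0 otherwise. -/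
open MeasureTheory
open scoped BigOperators Classical

noncomputable section

/-- The sign `(-1)^b` of a bit. -/
def bitSign (b : Bool) : ℂ := if b then -1 else 1

/-- A product over the entries of a tuple, grouped by value. -/
theorem prod_comp_eq_prod_pow_card {ι κ M : Type*} [Fintype ι] [Fintype κ] [DecidableEq κ]
    [CommMonoid M] (x : ι → κ) (g : κ → M) :
    ∏ i, g (x i) = ∏ s, g s ^ (Finset.univ.filter fun i => x i = s).card := by
  rw [← Finset.prod_fiberwise Finset.univ x]
  refine Finset.prod_congr rfl fun s _ => Finset.prod_eq_pow_card fun i hi => ?_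
  rw [(Finset.mem_filter.mp hi).2]

/-- The character sum over all Boolean functions of a monomial in the signs. -/
theorem sum_prod_bitSign_pow {κ : Type*} [Fintype κ] [DecidableEq κ] (m : κ → ℕ) :
    ∑ f : κ → Bool, ∏ s, bitSign (f s) ^ m s =
      if ∀ s, Even (m s) then (Fintype.card (κ → Bool) : ℂ) else 0 := by
  have h : ∑ f : κ → Bool, ∏ s, bitSign (f s) ^ m s = ∏ s, ∑ b : Bool, bitSign b ^ m s := by
    rw [Finset.prod_univ_sum, Fintype.piFinset_univ]
  rw [h]
  split_ifs with hm
  · have hs : ∀ s, ∑ b : Bool, bitSign b ^ m s = 2 := fun s => by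
      simp [bitSign, (hm s).neg_one_pow, one_add_one_eq_two]
    rw [Finset.prod_congr rfl fun s _ => hs s]
    simp
  · push Not at hm
    obtain ⟨s, hs⟩ := hm
    refine Finset.prod_eq_zero (Finset.mem_univ s) ?_
    simp [bitSign, (Nat.not_even_iff_odd.mp hs).neg_one_pow]

theorem outerT_ket2_apply (n t : ℕ) (f : Str n → Bool) (x y : Tup n t) :
    outerT n t (ket2 n f) x y = ((2 : ℂ) ^ (t * n))⁻¹ *
      ∏ s, bitSign (f s) ^ ((Finset.univ.filter fun i => x i = s).card +
        (Finset.univ.filter fun i => y i = s).card) := by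
  have hconj : ∀ s, (starRingEnd ℂ) (ket2 n f s) = ket2 n f s := fun s => by
    by_cases h : f s <;> simp [ket2, h]
  have hprod : ∀ z : Tup n t, ∏ i, ket2 n f (z i) =
      (∏ s, bitSign (f s) ^ (Finset.univ.filter fun i => z i = s).card) /
        ((Real.sqrt (2 ^ n) : ℝ) : ℂ) ^ t := fun z => by
    rw [← prod_comp_eq_prod_pow_card z fun s => bitSign (f s)]
    simp [ket2, bitSign, Finset.prod_div_distrib]
  have hsqrt : ((Real.sqrt (2 ^ n) : ℝ) : ℂ) ^ t * ((Real.sqrt (2 ^ n) : ℝ) : ℂ) ^ t =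
      2 ^ (t * n) := by
    rw [← mul_pow, ← Complex.ofReal_mul, Real.mul_self_sqrt (by positivity), mul_comm t, pow_mul]
    push_cast
    rfl
  simp only [outerT, Matrix.of_apply, map_prod, hconj]
  simp only [hprod, pow_add, Finset.prod_mul_distrib]
  rw [div_mul_div_comm, hsqrt, div_eq_inv_mul]

/-- For `n, t ≥ 1`, the entries of `ρ_{(t,n,2)}` are `2^{-tn}` at `(x, y)`
with `x, y` stabilizations of each other, and `0` otherwise. -/
theorem rho2_entries (n t : ℕ) (hn : 1 ≤ n) (ht : 1 ≤ t) (x y : Tup n t) :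
    rho2 n t x y = if IsStab n t x y then ((2 : ℂ) ^ (t * n))⁻¹ else 0 := by
  have hcard : (Fintype.card (Str n → Bool) : ℂ) ≠ 0 := Nat.cast_ne_zero.mpr Fintype.card_ne_zero
  simp only [rho2, Matrix.smul_apply, Matrix.sum_apply, outerT_ket2_apply, smul_eq_mul,
    ← Finset.mul_sum, sum_prod_bitSign_pow]
  by_cases h : IsStab n t x y
  · rw [if_pos (c := ∀ s, Even _) h, if_pos h, mul_comm, mul_assoc, mul_inv_cancel₀ hcard, mul_one]
  · rw [if_neg (c := ∀ s, Even _) h, if_neg h, mul_zero, mul_zero]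
end
end

section
/- For all natural numbers n ≥ 1 and t ≥ 1 with 2t(t−1) < 2ⁿ, the following real inequality holds: ∏_{i=1}^{t−1}(1 + i/2ⁿ) − ∏_{i=1}^{t−1}(1 − 2i/(2ⁿ + i)) ≤ 4t²/2ⁿ. -/
/-- If `m(m+1) ≤ N`, then `∏_{i=1}^{m}(1 + i/N) ≤ 1 + m(m+1)/N`. -/
theorem prod_one_add_div_le (N : ℝ) (hN : 0 < N) (m : ℕ) (h : (m : ℝ) * (m + 1) ≤ N) :
    ∏ i ∈ Finset.Icc 1 m, (1 + (i : ℝ) / N) ≤ 1 + m * (m + 1) / N := by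
  induction m with
  | zero => simp
  | succ k ih =>
    push_cast at h ⊢
    have hk : (0 : ℝ) ≤ k := k.cast_nonneg
    have hkN : (k : ℝ) * (k + 1) ≤ N := by nlinarith
    rw [Finset.prod_Icc_succ_top (by omega)]
    push_cast
    have hdiv : (k : ℝ) * (k + 1) / N ≤ 1 := (div_le_one hN).2 hkN
    have hpos : 0 ≤ ((k : ℝ) + 1) / N := by positivity
    calc _ ≤ (1 + (k : ℝ) * (k + 1) / N) * (1 + (k + 1) / N) := by gcongr; exact ih hkN
      _ = 1 + (k : ℝ) * (k + 1) / N + (k + 1) / N + k * (k + 1) / N * ((k + 1) / N) := by ring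
      _ ≤ 1 + (k : ℝ) * (k + 1) / N + (k + 1) / N + 1 * ((k + 1) / N) := by gcongr
      _ = _ := by ring

/-- If `m ≤ N`, then `∏_{i=1}^{m}(1 - 2i/(N + i))` lies in `[0, 1]` and is at least
`1 - m(m+1)/N`. -/
theorem prod_one_sub_div_bounds (N : ℝ) (hN : 0 < N) (m : ℕ) (h : (m : ℝ) ≤ N) :
    0 ≤ ∏ i ∈ Finset.Icc 1 m, (1 - 2 * (i : ℝ) / (N + i)) ∧
      ∏ i ∈ Finset.Icc 1 m, (1 - 2 * (i : ℝ) / (N + i)) ≤ 1 ∧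
      1 - m * (m + 1) / N ≤ ∏ i ∈ Finset.Icc 1 m, (1 - 2 * (i : ℝ) / (N + i)) := by
  induction m with
  | zero => simp
  | succ k ih =>
    push_cast at h ⊢
    have hk : (0 : ℝ) ≤ k := k.cast_nonneg
    obtain ⟨h0, h1, hlow⟩ := ih (by linarith)
    rw [Finset.prod_Icc_succ_top (by omega)]
    push_cast
    set B := ∏ i ∈ Finset.Icc 1 k, (1 - 2 * (i : ℝ) / (N + i))
    have hy0 : 0 ≤ 2 * ((k : ℝ) + 1) / (N + (k + 1)) := by positivity
    have hy1 : 2 * ((k : ℝ) + 1) / (N + (k + 1)) ≤ 1 :=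
      (div_le_one (by positivity)).2 (by linarith)
    have hyN : 2 * ((k : ℝ) + 1) / (N + (k + 1)) ≤ 2 * (k + 1) / N := by
      gcongr
      linarith
    have hsum : ((k : ℝ) + 1) * (k + 1 + 1) / N = k * (k + 1) / N + 2 * (k + 1) / N := by ring
    refine ⟨mul_nonneg h0 (by linarith), by nlinarith, ?_⟩
    rw [hsum]
    nlinarith

/-- For `n, t ≥ 1` with `2t(t-1) < 2ⁿ`,
`∏_{i=1}^{t-1}(1 + i/2ⁿ) - ∏_{i=1}^{t-1}(1 - 2i/(2ⁿ + i)) ≤ 4t²/2ⁿ`. -/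
theorem prod_diff_le (n t : ℕ) (hn : 1 ≤ n) (ht : 1 ≤ t) (h : 2 * t * (t - 1) < 2 ^ n) :
    (∏ i ∈ Finset.Icc 1 (t - 1), (1 + (i : ℝ) / 2 ^ n)) -
        ∏ i ∈ Finset.Icc 1 (t - 1), (1 - 2 * (i : ℝ) / (2 ^ n + i)) ≤
      4 * (t : ℝ) ^ 2 / 2 ^ n := by
  obtain ⟨m, rfl⟩ := Nat.exists_eq_add_of_le' ht
  simp only [Nat.add_sub_cancel] at h ⊢
  have hm : (0 : ℝ) ≤ m := m.cast_nonneg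
  have hR : 2 * ((m : ℝ) + 1) * m < 2 ^ n := by exact_mod_cast h
  have hN : (0 : ℝ) < 2 ^ n := by positivity
  have hA := prod_one_add_div_le (2 ^ n) hN m (by nlinarith)
  have hB := (prod_one_sub_div_bounds (2 ^ n) hN m (by nlinarith)).2.2
  have hle : 2 * ((m : ℝ) * (m + 1) / 2 ^ n) ≤ 4 * ((m + 1 : ℕ) : ℝ) ^ 2 / 2 ^ n := by
    rw [← mul_div_assoc]
    refine div_le_div_of_nonneg_right ?_ hN.le
    push_cast
    nlinarith
  linarith
end

section
/- For all natural numbers n ≥ 1 and 1 ≤ t ≤ 2ⁿ − 1, the trace distance between the t-copy random binary phase mixed state and the t-copy random complex phase mixed state satisfies td(ρ_{(t,n,2)}, ρ_{(t,n,2ⁿ)}) ≤ (C(2ⁿ + t − 1, t) − C(2ⁿ, t)) · t!/2^{tn}, where C(·,·) denotes the binomial coefficient. -/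
open MeasureTheory
open scoped BigOperators Classical

noncomputable section

open scoped ComplexOrder Matrix

/-- The trace norm of a difference of positive semidefinite matrices is at most the sum of their
traces. -/
theorem sum_abs_eigenvalues_sub_le {m : Type*} [Fintype m] [DecidableEq m] {M A B : Matrix m m ℂ}
    (hA : A.PosSemidef) (hB : B.PosSemidef) (h : M.IsHermitian) (hM : M = A - B) :
    ∑ i, |h.eigenvalues i| ≤ A.trace.re + B.trace.re := by
  let U : Matrix m m ℂ := (h.eigenvectorUnitary : Matrix m m ℂ)
  have hUU : U * Uᴴ = 1 := Unitary.coe_mul_star_self h.eigenvectorUnitary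
  have trace_conj (C : Matrix m m ℂ) : (Uᴴ * C * U).trace = C.trace := by
    rw [Matrix.trace_mul_comm, ← Matrix.mul_assoc, hUU, Matrix.one_mul]
  have key : Uᴴ * A * U - Uᴴ * B * U = Matrix.diagonal (RCLike.ofReal ∘ h.eigenvalues) := by
    rw [← h.conjStarAlgAut_star_eigenvectorUnitary, Unitary.conjStarAlgAut_star_apply,
      ← Matrix.sub_mul, ← Matrix.mul_sub, ← hM]
    rfl
  rw [← trace_conj A, ← trace_conj B, Matrix.trace, Matrix.trace, Complex.re_sum, Complex.re_sum,
    ← Finset.sum_add_distrib]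
  refine Finset.sum_le_sum fun i _ => ?_
  have ha := (Complex.nonneg_iff.1 ((hA.conjTranspose_mul_mul_same U).diag_nonneg (i := i))).1
  have hb := (Complex.nonneg_iff.1 ((hB.conjTranspose_mul_mul_same U).diag_nonneg (i := i))).1
  have hd : (Uᴴ * A * U) i i - (Uᴴ * B * U) i i = (h.eigenvalues i : ℂ) := by
    simpa using congrFun (congrFun key i) i
  have hre := congrArg Complex.re hd
  rw [Complex.sub_re, Complex.ofReal_re] at hre
  rw [Matrix.diag_apply, Matrix.diag_apply, abs_le]
  constructor <;> linarith

/-- The `t`-copy mixed state of a vector whose amplitudes are drawn independently and uniformly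
from the values of `g`. -/
def phaseMix (n t : ℕ) {α : Type*} [Fintype α] (g : α → ℂ) : Matrix (Tup n t) (Tup n t) ℂ :=
  (Fintype.card (Str n → α) : ℂ)⁻¹ • ∑ f : Str n → α, outerT n t (fun x => g (f x))

section phaseMix

variable {n t : ℕ} {α : Type*} [Fintype α] {g : α → ℂ}

theorem phaseMix_apply (x y : Tup n t) :
    phaseMix n t g x y = (Fintype.card (Str n → α) : ℂ)⁻¹ *
      ∑ f : Str n → α, (∏ i, g (f (x i))) * (starRingEnd ℂ) (∏ i, g (f (y i))) := by
  simp [phaseMix, outerT, Matrix.sum_apply]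

theorem phaseMix_posSemidef : (phaseMix n t g).PosSemidef := by
  refine Matrix.PosSemidef.smul (Matrix.posSemidef_sum _ fun f _ => ?_) (by positivity)
  exact Matrix.posSemidef_vecMulVec_self_star (fun x : Tup n t => ∏ i, g (f (x i)))

theorem phaseMix_apply_of_perm [Nonempty α] {c : ℝ} (hg : ∀ a, g a * (starRingEnd ℂ) (g a) = c)
    {x y : Tup n t} {σ : Fin t → Fin t} (hσ : σ.Bijective) (hxy : ∀ i, y (σ i) = x i) :
    phaseMix n t g x y = c ^ t := by
  have hf (f : Str n → α) :
      (∏ i, g (f (x i))) * (starRingEnd ℂ) (∏ i, g (f (y i))) = (c : ℂ) ^ t := by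
    rw [← hσ.prod_comp fun i => g (f (y i)), map_prod, ← Finset.prod_mul_distrib]
    simp [hxy, hg]
  rw [phaseMix_apply, Finset.sum_congr rfl fun f _ => hf f, Finset.sum_const, nsmul_eq_mul,
    Finset.card_univ, inv_mul_cancel_left₀ (Nat.cast_ne_zero.2 Fintype.card_ne_zero)]

theorem phaseMix_apply_eq_zero (hg : ∑ a, g a = 0) {x y : Tup n t} (hx : x.Injective) {i₀ : Fin t}
    (hy : ∀ j, y j ≠ x i₀) : phaseMix n t g x y = 0 := by
  rw [phaseMix_apply, ← (Equiv.funSplitAt (x i₀) α).symm.sum_comp, Fintype.sum_prod_type_right]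
  refine mul_eq_zero_of_right _ (Finset.sum_eq_zero fun r _ => ?_)
  have hx' (i : Fin t) (hi : i ≠ i₀) : x i ≠ x i₀ := hx.ne hi
  have hprod (a : α) : ∏ i ∈ Finset.univ.erase i₀,
      g ((Equiv.funSplitAt (x i₀) α).symm (a, r) (x i)) =
        ∏ i ∈ Finset.univ.erase i₀, if h : x i = x i₀ then 1 else g (r ⟨x i, h⟩) :=
    Finset.prod_congr rfl fun i hi => by simp [hx' i (Finset.ne_of_mem_erase hi)]
  have hsplit (a : α) : ∏ i, g ((Equiv.funSplitAt (x i₀) α).symm (a, r) (x i)) =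
      g a * ∏ i ∈ Finset.univ.erase i₀, if h : x i = x i₀ then 1 else g (r ⟨x i, h⟩) := by
    rw [← Finset.mul_prod_erase _ _ (Finset.mem_univ i₀), hprod]
    simp
  simp_rw [hsplit, mul_assoc]
  simp [hy, ← Finset.sum_mul, hg]

theorem phaseMix_eq_of_injective {β : Type*} [Fintype β] {k : β → ℂ} [Nonempty α] [Nonempty β]
    {c : ℝ} (hg : ∀ a, g a * (starRingEnd ℂ) (g a) = c) (hg0 : ∑ a, g a = 0)
    (hk : ∀ b, k b * (starRingEnd ℂ) (k b) = c) (hk0 : ∑ b, k b = 0)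
    {x y : Tup n t} (hx : x.Injective) : phaseMix n t g x y = phaseMix n t k x y := by
  by_cases hxy : ∀ i, ∃ j, y j = x i
  · choose σ hσ using hxy
    have hinj : σ.Injective := fun i j hij => hx (by rw [← hσ, ← hσ, hij])
    have hbij := Finite.injective_iff_bijective.1 hinj
    rw [phaseMix_apply_of_perm hg hbij hσ, phaseMix_apply_of_perm hk hbij hσ]
  · push Not at hxy
    obtain ⟨i₀, hi₀⟩ := hxy
    rw [phaseMix_apply_eq_zero hg0 hx hi₀, phaseMix_apply_eq_zero hk0 hx hi₀]

theorem phaseMix_eq_of_injective_or {β : Type*} [Fintype β] {k : β → ℂ} [Nonempty α] [Nonempty β]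
    {c : ℝ} (hg : ∀ a, g a * (starRingEnd ℂ) (g a) = c) (hg0 : ∑ a, g a = 0)
    (hk : ∀ b, k b * (starRingEnd ℂ) (k b) = c) (hk0 : ∑ b, k b = 0)
    {x y : Tup n t} (h : x.Injective ∨ y.Injective) :
    phaseMix n t g x y = phaseMix n t k x y := by
  rcases h with hx | hy
  · exact phaseMix_eq_of_injective hg hg0 hk hk0 hx
  · rw [← phaseMix_posSemidef.isHermitian.apply, ← phaseMix_posSemidef.isHermitian.apply (i := x),
      phaseMix_eq_of_injective hg hg0 hk hk0 hy]

end phaseMix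

theorem card_not_injective (n t : ℕ) :
    (Fintype.card {x : Tup n t // ¬ x.Injective} : ℝ) =
      2 ^ (t * n) - (2 ^ n).choose t * t.factorial := by
  have hinj : Fintype.card {x : Tup n t // x.Injective} = (2 ^ n).descFactorial t := by
    rw [Fintype.card_congr (Equiv.subtypeInjectiveEquivEmbedding (Fin t) (Str n)),
      Fintype.card_embedding_eq]
    simp
  rw [Fintype.card_subtype_compl, hinj, Nat.cast_sub, Nat.descFactorial_eq_factorial_mul_choose]
  · simp only [Fintype.card_fun, Fintype.card_bool, Fintype.card_fin]
    push_cast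
    ring
  · rw [← hinj]
    exact Fintype.card_subtype_le _

/-- The compression of a matrix on tuples to the span of the non-injective tuples. -/
def collisionPart {n t : ℕ} (M : Matrix (Tup n t) (Tup n t) ℂ) : Matrix (Tup n t) (Tup n t) ℂ :=
  (Matrix.diagonal fun x => if x.Injective then 0 else 1)ᴴ * M *
    Matrix.diagonal fun x => if x.Injective then 0 else 1

theorem collisionPart_apply {n t : ℕ} (M : Matrix (Tup n t) (Tup n t) ℂ) (x y : Tup n t) :
    collisionPart M x y = if x.Injective ∨ y.Injective then 0 else M x y := by
  by_cases hx : x.Injective <;> by_cases hy : y.Injective <;>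
    simp [collisionPart, Matrix.diagonal_conjTranspose, hx, hy]

theorem trace_collisionPart_phaseMix {n t : ℕ} {α : Type*} [Fintype α] [Nonempty α] {g : α → ℂ}
    {c : ℝ} (hg : ∀ a, g a * (starRingEnd ℂ) (g a) = c) :
    (collisionPart (phaseMix n t g)).trace.re =
      (2 ^ (t * n) - (2 ^ n).choose t * t.factorial) * c ^ t := by
  have hdiag (x : Tup n t) : collisionPart (phaseMix n t g) x x =
      if ¬ x.Injective then ((c ^ t : ℝ) : ℂ) else 0 := by
    rw [collisionPart_apply,
      phaseMix_apply_of_perm (x := x) (y := x) hg Function.bijective_id fun _ => rfl]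
    by_cases hx : x.Injective <;> simp [hx]
  simp only [Matrix.trace, Matrix.diag_apply, hdiag]
  rw [← Finset.sum_filter, Finset.sum_const, ← Fintype.card_subtype, nsmul_eq_mul,
    ← card_not_injective, ← Complex.ofReal_natCast, ← Complex.ofReal_mul, Complex.ofReal_re]

theorem div_sqrt_mul_conj (n : ℕ) {z : ℂ} (hz : ‖z‖ = 1) :
    z / Real.sqrt (2 ^ n) * (starRingEnd ℂ) (z / Real.sqrt (2 ^ n)) = ((1 / 2 ^ n : ℝ) : ℂ) := by
  rw [Complex.mul_conj, Complex.normSq_eq_norm_sq, norm_div, hz, Complex.norm_real, div_pow,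
    Real.norm_eq_abs, sq_abs, Real.sq_sqrt (by positivity), one_pow]

theorem sum_exp_div_eq_zero {n : ℕ} (hn : 1 ≤ n) :
    ∑ a : Fin (2 ^ n), Complex.exp (2 * Real.pi * Complex.I * ((a : ℕ) : ℂ) / (2 ^ n)) = 0 := by
  have hprim := Complex.isPrimitiveRoot_exp (2 ^ n) (by positivity)
  rw [← hprim.geom_sum_eq_zero (Nat.one_lt_two_pow (by omega)), ← Fin.sum_univ_eq_sum_range]
  refine Finset.sum_congr rfl fun a _ => ?_
  rw [← Complex.exp_nat_mul]
  push_cast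
  ring_nf

/-- For `n ≥ 1` and `1 ≤ t ≤ 2ⁿ - 1`,
`td(ρ_{(t,n,2)}, ρ_{(t,n,2ⁿ)}) ≤ (C(2ⁿ + t - 1, t) - C(2ⁿ, t)) · t!/2^{tn}`. -/
theorem td_binary_complex_le_choose (n t : ℕ) (hn : 1 ≤ n) (ht1 : 1 ≤ t)
    (ht2 : t ≤ 2 ^ n - 1) (h : (rho2 n t - rhoC n t).IsHermitian) :
    (1 / 2 : ℝ) * ∑ i, |h.eigenvalues i| ≤
      (((2 ^ n + t - 1).choose t : ℝ) - ((2 ^ n).choose t : ℝ)) * (t.factorial : ℝ) /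
        2 ^ (t * n) := by
  set g : Bool → ℂ := fun b => (if b then (-1 : ℂ) else 1) / Real.sqrt (2 ^ n) with hg
  set k : Fin (2 ^ n) → ℂ := fun a =>
    Complex.exp (2 * Real.pi * Complex.I * ((a : ℕ) : ℂ) / (2 ^ n)) / Real.sqrt (2 ^ n)
  have hg1 (b : Bool) : g b * (starRingEnd ℂ) (g b) = ((1 / 2 ^ n : ℝ) : ℂ) :=
    div_sqrt_mul_conj n (by cases b <;> simp)
  have hk1 (a : Fin (2 ^ n)) : k a * (starRingEnd ℂ) (k a) = ((1 / 2 ^ n : ℝ) : ℂ) := by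
    refine div_sqrt_mul_conj n ?_
    rw [show 2 * Real.pi * Complex.I * ((a : ℕ) : ℂ) / 2 ^ n =
      ((2 * Real.pi * (a : ℕ) / 2 ^ n : ℝ) : ℂ) * Complex.I by push_cast; ring]
    exact Complex.norm_exp_ofReal_mul_I _
  have hg0 : ∑ b, g b = 0 := by simp [hg, neg_div]
  have hk0 : ∑ a, k a = 0 := by rw [← Finset.sum_div, sum_exp_div_eq_zero hn, zero_div]
  have hsub : rho2 n t - rhoC n t =
      collisionPart (phaseMix n t g) - collisionPart (phaseMix n t k) := by
    change phaseMix n t g - phaseMix n t k = _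
    ext x y
    rw [Matrix.sub_apply, Matrix.sub_apply, collisionPart_apply, collisionPart_apply]
    split_ifs with hxy
    · rw [phaseMix_eq_of_injective_or hg1 hg0 hk1 hk0 hxy, sub_self, sub_self]
    · rfl
  have hle := sum_abs_eigenvalues_sub_le (phaseMix_posSemidef.conjTranspose_mul_mul_same _)
    (phaseMix_posSemidef.conjTranspose_mul_mul_same _) h hsub
  change _ ≤ (collisionPart _).trace.re + (collisionPart _).trace.re at hle
  rw [trace_collisionPart_phaseMix hg1, trace_collisionPart_phaseMix hk1] at hle
  have hasc : (2 : ℝ) ^ (t * n) ≤ t.factorial * (2 ^ n + t - 1).choose t := by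
    have := Nat.pow_succ_le_ascFactorial (2 ^ n) t
    rw [Nat.ascFactorial_eq_factorial_mul_choose', ← pow_mul, mul_comm n t] at this
    exact_mod_cast this
  rw [one_div_pow, ← pow_mul, mul_comm n t, mul_one_div] at hle
  calc (1 / 2 : ℝ) * ∑ i, |h.eigenvalues i|
      ≤ (2 ^ (t * n) - (2 ^ n).choose t * t.factorial) / 2 ^ (t * n) := by linarith
    _ ≤ _ := by
      gcongr
      linarith
end
end
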